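/- The set of homotopy classes of continuous maps S³ → S² — that is, the quotient of the space C(S³, S²) of continuous maps by the equivalence relation of (unbased) homotopy — is in bijection with the integers ℤ. -/

import Mathlib

open MeasureTheory
open scoped ContDiff

set_option linter.unusedSectionVars false
section INV
variable {E : Type*} [NormedAddCommGroup E] [NormedSpace ℝ E] [FiniteDimensional ℝ E]
  [MeasurableSpace E] [BorelSpace E] {ι : Type*} [Fintype ι] [DecidableEq ι]

/-- Jacobian determinant of a family of functions. -/
noncomputable def jac (e : ι → E) (f : ι → E → ℝ) (x : E) : ℝ :=
  (Matrix.of fun i j => fderiv ℝ (f i) x (e j)).det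

lemma jac_eq (e : ι → E) (f : ι → E → ℝ) (x : E) (i₀ : ι) :
    jac e f x = ∑ σ : Equiv.Perm ι, (Equiv.Perm.sign σ : ℝ) *
      ((∏ i ∈ Finset.univ.erase i₀, fderiv ℝ (f i) x (e (σ i))) *
        fderiv ℝ (f i₀) x (e (σ i₀))) := by
  rw [jac, ← Matrix.det_transpose, Matrix.det_apply']
  refine Finset.sum_congr rfl fun σ _ => ?_
  rw [Finset.prod_erase_mul _ _ (Finset.mem_univ i₀)]
  simp

lemma contDiff_dir {f : E → ℝ} (hf : ContDiff ℝ ∞ f) (v : E) :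
    ContDiff ℝ ∞ (fun x => fderiv ℝ f x v) :=
  (hf.fderiv_right (m := ∞) (by simp)).clm_apply contDiff_const

lemma continuous_jac (e : ι → E) {f : ι → E → ℝ} (hf : ∀ i, ContDiff ℝ ∞ (f i)) :
    Continuous (jac e f) := by
  unfold jac
  refine Continuous.matrix_det ?_
  refine continuous_matrix fun i j => ?_
  exact (contDiff_dir (hf i) (e j)).continuous

lemma piola (e : ι → E) {f : ι → E → ℝ} (hf : ∀ i, ContDiff ℝ ∞ (f i)) (i₀ : ι) (x : E) :
    ∑ σ : Equiv.Perm ι, (Equiv.Perm.sign σ : ℝ) *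
      fderiv ℝ (fun x => ∏ i ∈ Finset.univ.erase i₀, fderiv ℝ (f i) x (e (σ i))) x (e (σ i₀))
      = 0 := by
  have h1 : ∀ σ : Equiv.Perm ι, 
      fderiv ℝ (fun x => ∏ i ∈ Finset.univ.erase i₀, fderiv ℝ (f i) x (e (σ i))) x (e (σ i₀))
      = ∑ k ∈ Finset.univ.erase i₀, 
        (∏ i ∈ (Finset.univ.erase i₀).erase k, fderiv ℝ (f i) x (e (σ i))) *
          fderiv ℝ (fderiv ℝ (f k)) x (e (σ i₀)) (e (σ k)) := by
    intro σ
    rw [(HasFDerivAt.finsetProd (u := Finset.univ.erase i₀) 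
      (g := fun i x => fderiv ℝ (f i) x (e (σ i))) (x := x)
      (fun i _ => ((contDiff_dir (hf i) (e (σ i))).differentiable (by simp) x).hasFDerivAt)).fderiv]
    simp only [sum_apply, smul_apply, smul_eq_mul]
    refine Finset.sum_congr rfl fun k _ => ?_
    congr 1
    have hd : DifferentiableAt ℝ (fderiv ℝ (f k)) x :=
      ((hf k).fderiv_right (m := ∞) (by simp)).differentiable (by simp) x
    rw [fderiv_clm_apply hd (differentiableAt_const _)]
    simp
  simp_rw [h1, Finset.mul_sum]
  rw [Finset.sum_comm]
  refine Finset.sum_eq_zero fun k hk => ?_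
  have hk' : k ≠ i₀ := Finset.ne_of_mem_erase hk
  refine Finset.sum_involution (fun σ _ => σ * Equiv.swap i₀ k) ?_ ?_ ?_ ?_
  · intro σ _
    have hs : IsSymmSndFDerivAt ℝ (f k) x :=
      ((hf k).contDiffAt).isSymmSndFDerivAt (by simp only [minSmoothness_of_isRCLikeNormedField]; exact WithTop.coe_le_coe.2 le_top)
    have hp : ∏ i ∈ (Finset.univ.erase i₀).erase k, fderiv ℝ (f i) x (e ((σ * Equiv.swap i₀ k) i))
      = ∏ i ∈ (Finset.univ.erase i₀).erase k, fderiv ℝ (f i) x (e (σ i)) := by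
      refine Finset.prod_congr rfl fun i hi => ?_
      simp only [Finset.mem_erase] at hi
      rw [Equiv.Perm.mul_apply, Equiv.swap_apply_of_ne_of_ne hi.2.1 hi.1]
    rw [hp]
    simp only [Equiv.Perm.mul_apply, Equiv.swap_apply_left, Equiv.swap_apply_right,
      Equiv.Perm.sign_mul, Equiv.Perm.sign_swap hk'.symm]
    rw [hs.eq (e (σ k))]
    push_cast
    simp
  · intro σ _ _ h
    have := congrArg (fun τ => τ i₀) h
    simp at this
    exact hk' this
  · intros; simp
  · intro σ _; simp [mul_assoc]

lemma jac_integral_zero (μ : Measure E) [μ.IsAddHaarMeasure]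
    (e : ι → E) {f : ι → E → ℝ} (hf : ∀ i, ContDiff ℝ ∞ (f i)) (i₀ : ι)
    (hc : HasCompactSupport (f i₀)) :
    Integrable (jac e f) μ ∧ ∫ x, jac e f x ∂μ = 0 := by
  have hcd : ∀ v, HasCompactSupport (fun x => fderiv ℝ (f i₀) x v) := fun v =>
    hc.fderiv_apply ℝ v
  have hwsm : ∀ σ : Equiv.Perm ι, ContDiff ℝ ∞ 
    (fun x => ∏ i ∈ Finset.univ.erase i₀, fderiv ℝ (f i) x (e (σ i))) := fun σ => 
      contDiff_prod fun i _ => contDiff_dir (hf i) _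
  have hIg : ∀ σ : Equiv.Perm ι, Integrable (fun x =>  
      ((∏ i ∈ Finset.univ.erase i₀, fderiv ℝ (f i) x (e (σ i))) *
        fderiv ℝ (f i₀) x (e (σ i₀)))) μ := fun σ => 
      Continuous.integrable_of_hasCompactSupport 
        ((hwsm σ).continuous.mul (contDiff_dir (hf i₀) _).continuous) (hcd _).mul_left
  have hIg2 : ∀ σ : Equiv.Perm ι, Integrable (fun x => fderiv ℝ (fun x => 
      (∏ i ∈ Finset.univ.erase i₀, fderiv ℝ (f i) x (e (σ i)))) x (e (σ i₀)) * f i₀ x) μ := fun σ => 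
      Continuous.integrable_of_hasCompactSupport 
        ((contDiff_dir (hwsm σ) _).continuous.mul (hf i₀).continuous) hc.mul_left
  have hIg3 : ∀ σ : Equiv.Perm ι, Integrable (fun x =>  
      (∏ i ∈ Finset.univ.erase i₀, fderiv ℝ (f i) x (e (σ i))) * f i₀ x) μ := fun σ => 
      Continuous.integrable_of_hasCompactSupport 
        ((hwsm σ).continuous.mul (hf i₀).continuous) hc.mul_left
  have hj : jac e f = fun x => ∑ σ : Equiv.Perm ι, (Equiv.Perm.sign σ : ℝ) *
      ((∏ i ∈ Finset.univ.erase i₀, fderiv ℝ (f i) x (e (σ i))) *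
        fderiv ℝ (f i₀) x (e (σ i₀))) := funext fun x => jac_eq e f x i₀
  rw [hj]
  refine ⟨integrable_finsetSum _ fun σ _ => (hIg σ).const_mul _, ?_⟩
  rw [integral_finsetSum _ fun σ _ => (hIg σ).const_mul _]
  have : ∀ σ : Equiv.Perm ι, ∫ x, (Equiv.Perm.sign σ : ℝ) *
      ((∏ i ∈ Finset.univ.erase i₀, fderiv ℝ (f i) x (e (σ i))) *
        fderiv ℝ (f i₀) x (e (σ i₀))) ∂μ = - ∫ x, (Equiv.Perm.sign σ : ℝ) *
        (fderiv ℝ (fun x => 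
      (∏ i ∈ Finset.univ.erase i₀, fderiv ℝ (f i) x (e (σ i)))) x (e (σ i₀)) * f i₀ x) ∂μ := by
    intro σ
    rw [integral_const_mul, integral_const_mul, ← mul_neg]
    congr 1
    exact integral_mul_fderiv_eq_neg_fderiv_mul_of_integrable (hIg2 σ) (hIg σ) (hIg3 σ)
      (fun x _ => (hwsm σ).differentiable (by simp) x) 
      (fun x _ => (hf i₀).differentiable (by simp) x)
  simp_rw [this]
  rw [Finset.sum_neg_distrib, ← integral_finsetSum _ fun σ _ => (hIg2 σ).const_mul _]
  simp_rw [← mul_assoc, ← Finset.sum_mul]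
  simp [piola e hf i₀]

lemma jac_update (e : ι → E) (f : ι → E → ℝ) (hf : ∀ i, ContDiff ℝ ∞ (f i)) (i₀ : ι)
    (g : E → ℝ) (hg : ContDiff ℝ ∞ g) (x : E) :
    jac e f x - jac e (Function.update f i₀ g) x = jac e (Function.update f i₀ (f i₀ - g)) x := by
  have key : ∀ h : E → ℝ, jac e (Function.update f i₀ h) x =
    ((Matrix.of fun i j => fderiv ℝ (f i) x (e j)).updateRow i₀ (fun j => fderiv ℝ h x (e j))).det := by
    intro h
    unfold jac
    congr 1
    ext i j
    by_cases hi : i = i₀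
    · subst hi; simp
    · simp [hi]
  have : jac e f x = jac e (Function.update f i₀ (f i₀)) x := by simp
  rw [this, key, key, key, sub_eq_iff_eq_add, ← Matrix.det_updateRow_add]
  congr 2
  ext j
  rw [fderiv_sub ((hf i₀).differentiable (by simp) x) (hg.differentiable (by simp) x)]
  simp

lemma jac_invariance (μ : Measure E) [μ.IsAddHaarMeasure]
    (e : ι → E) {f g : ι → E → ℝ} (hf : ∀ i, ContDiff ℝ ∞ (f i)) (hg : ∀ i, ContDiff ℝ ∞ (g i))
    (hc : ∀ i, HasCompactSupport (f i - g i)) :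
    Integrable (fun x => jac e f x - jac e g x) μ ∧ ∫ x, jac e f x - jac e g x ∂μ = 0 := by
  have key : ∀ s : Finset ι, Integrable (fun x => jac e f x - jac e (s.piecewise g f) x) μ ∧
      ∫ x, jac e f x - jac e (s.piecewise g f) x ∂μ = 0 := by
    intro s
    induction s using Finset.induction_on with
    | empty => simp
    | insert a s ha ih =>
      have hsm : ∀ i, ContDiff ℝ ∞ (s.piecewise g f i) := by
        intro i
        by_cases h : i ∈ s <;> simp [h, hf, hg]
      rw [Finset.piecewise_insert]
      have h1 : ∀ x, jac e f x - jac e (Function.update (s.piecewise g f) a (g a)) x =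
        (jac e f x - jac e (s.piecewise g f) x) +
          jac e (Function.update (s.piecewise g f) a (f a - g a)) x := by
        intro x
        have := jac_update e (s.piecewise g f) hsm a (g a) (hg a) x
        rw [Finset.piecewise_eq_of_notMem _ _ _ ha] at this
        rw [← this]; ring
      have h2 := jac_integral_zero μ e (f := Function.update (s.piecewise g f) a (f a - g a))
        (by
          intro i
          by_cases h : i = a
          · subst h; rw [Function.update_self]; exact (hf i).sub (hg i)
          · simpa [h] using hsm i) a (by simpa using hc a)
      simp_rw [h1]
      refine ⟨ih.1.add h2.1, ?_⟩
      rw [integral_add ih.1 h2.1, ih.2, h2.2, add_zero]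
  have := key Finset.univ
  simpa using this

lemma det_invariance (μ : Measure E) [μ.IsAddHaarMeasure] 
    (b : Module.Basis ι ℝ E) {F G : E → E} (hF : ContDiff ℝ ∞ F) (hG : ContDiff ℝ ∞ G)
    (hc : HasCompactSupport (F - G)) :
    ∫ x, (fderiv ℝ F x).det - (fderiv ℝ G x).det ∂μ = 0 := by
  let l : ι → E →L[ℝ] ℝ := fun i => LinearMap.toContinuousLinearMap (b.coord i)
  have key : ∀ F : E → E, ContDiff ℝ ∞ F → ∀ x, (fderiv ℝ F x).det = jac b (fun i x => l i (F x)) x := by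
    intro F hF x
    unfold jac
    rw [ContinuousLinearMap.det, ← LinearMap.det_toMatrix b]
    congr 1
    ext i j
    rw [LinearMap.toMatrix_apply]
    simp only [Matrix.of_apply]
    have := ((l i).hasFDerivAt.comp x (hF.differentiable (by simp) x).hasFDerivAt).fderiv
    rw [show (fun x => l i (F x)) = l i ∘ F from rfl, this]
    simp [l]
  simp_rw [key F hF, key G hG]
  refine (jac_invariance μ b (fun i => (l i).contDiff.comp hF) (fun i => (l i).contDiff.comp hG) ?_).2
  intro i
  have : (l i ∘ F - l i ∘ G) = l i ∘ (F - G) := by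
    ext x; simp
  rw [this]
  exact hc.comp_left (map_zero _)
end INV

lemma det_nonneg_of_commute {V : Type*} [AddCommGroup V] [Module ℝ V]
    (J L : V →ₗ[ℝ] V) (hJ : J * J = -1) (h : ∀ v, L (J v) = J (L v)) : 0 ≤ LinearMap.det L := by
  let φ : ℂ →ₐ[ℝ] Module.End ℝ V := Complex.lift ⟨J, hJ⟩
  let : Module ℂ V := Module.compHom V φ.toRingHom
  have hsm : ∀ (z : ℂ) (v : V), z • v = z.re • v + z.im • J v := by
    intro z v
    change φ z v = _
    simp [φ, Complex.liftAux_apply]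
  have : IsScalarTower ℝ ℂ V := ⟨fun r z v => by simp [hsm, smul_add, smul_smul]⟩
  let L' : V →ₗ[ℂ] V := { L with 
    map_smul' := fun z v => by simp [hsm, h] }
  have : L = L'.restrictScalars ℝ := rfl
  rw [this, LinearMap.det_restrictScalars, Algebra.norm_complex_apply]
  exact Complex.normSq_nonneg _
open Quaternion

/-- The real coordinates as continuous linear functionals. -/
noncomputable def qco (i : Fin 4) : ℍ[ℝ] →L[ℝ] ℝ :=
  LinearMap.toContinuousLinearMap ((QuaternionAlgebra.basisOneIJK (-1:ℝ) 0 (-1)).coord i)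

lemma qco_apply (i : Fin 4) (y : ℍ[ℝ]) : qco i y = ![y.re, y.imI, y.imJ, y.imK] i := by
  exact congrFun (QuaternionAlgebra.coe_basisOneIJK_repr (-1:ℝ) 0 (-1) y) i

lemma deriv_transition_zero {s : ℝ} (h : s < 0 ∨ 1 < s) : deriv Real.smoothTransition s = 0 := by
  rcases h with h | h
  · have : Real.smoothTransition =ᶠ[nhds s] fun _ => 0 := by
      filter_upwards [Iio_mem_nhds h] with x hx
      exact Real.smoothTransition.zero_of_nonpos (le_of_lt hx)
    rw [this.deriv_eq]; simp
  · have : Real.smoothTransition =ᶠ[nhds s] fun _ => 1 := by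
      filter_upwards [Ioi_mem_nhds h] with x hx
      exact Real.smoothTransition.one_of_one_le (le_of_lt hx)
    rw [this.deriv_eq]; simp

lemma exists_Phi : ∃ Φ : ℍ[ℝ] → ℍ[ℝ], ContDiff ℝ ∞ Φ ∧ (∀ y, 0 ≤ (fderiv ℝ Φ y).det) ∧
    (∀ y, 1/2 ≤ ‖y‖ → (fderiv ℝ Φ y).det = 0) ∧
    ∃ t : ℝ, 0 < t ∧ 0 < (fderiv ℝ Φ (t : ℍ[ℝ])).det := by
  let β : ContDiffBump (0:ℝ) := ⟨1/16, 1/8, by norm_num, by norm_num⟩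
  let c : ℍ[ℝ] → ℝ := fun y => β (qco 1 y) * β (qco 2 y) * β (qco 3 y)
  have hβ : ContDiff ℝ ∞ β := β.contDiff
  have hc : ContDiff ℝ ∞ c := 
    ((hβ.comp (qco 1).contDiff).mul (hβ.comp (qco 2).contDiff)).mul (hβ.comp (qco 3).contDiff)
  let B : ℍ[ℝ] → ℝ := fun y => Real.smoothTransition (8 * qco 0 y)
  have hB : ContDiff ℝ ∞ B := Real.smoothTransition.contDiff.comp 
    (contDiff_const.mul (qco 0).contDiff)
  let u : ℍ[ℝ] → ℝ := fun y => B y * c y - qco 0 y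
  have hu : ContDiff ℝ ∞ u := (hB.mul hc).sub (qco 0).contDiff
  let Φ : ℍ[ℝ] → ℍ[ℝ] := fun y => y + u y • (1 : ℍ[ℝ])
  have hΦ : ContDiff ℝ ∞ Φ := contDiff_id.add (hu.smul contDiff_const)
  have hdet : ∀ y, (fderiv ℝ Φ y).det = 8 * deriv Real.smoothTransition (8 * y.re) * c y := by
    intro y
    have h1 : HasFDerivAt Φ (ContinuousLinearMap.id ℝ ℍ[ℝ] + (fderiv ℝ u y).smulRight (1:ℍ[ℝ])) y :=
      (hasFDerivAt_id y).add (((hu.differentiable (by simp) y).hasFDerivAt).smul_const (1:ℍ[ℝ]))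
    rw [h1.fderiv]
    have h2 : ((ContinuousLinearMap.id ℝ ℍ[ℝ] + (fderiv ℝ u y).smulRight (1:ℍ[ℝ])) : ℍ[ℝ] →L[ℝ] ℍ[ℝ]).det
      = 1 + fderiv ℝ u y 1 := by
      rw [← ContinuousLinearMap.coe_coe (fderiv ℝ u y), ← LinearMap.transvection.det]
      rw [ContinuousLinearMap.det]
      congr 1
    rw [h2]
    have h3 : HasDerivAt (fun t : ℝ => u (y + t • (1:ℍ[ℝ]))) (fderiv ℝ u y 1) 0 := by
      have := (hu.differentiable (by simp) (y + (0:ℝ) • 1)).hasFDerivAt.comp_hasDerivAt (0:ℝ)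
        (((hasDerivAt_id (0:ℝ)).smul_const (1:ℍ[ℝ])).const_add y)
      simpa [Function.comp_def] using this
    have h4 : (fun t : ℝ => u (y + t • (1:ℍ[ℝ]))) = fun t => 
        Real.smoothTransition (8 * (y.re + t)) * c y - (y.re + t) := by
      funext t
      simp [u, B, c, qco_apply]
    have h5 : HasDerivAt (fun t : ℝ => Real.smoothTransition (8 * (y.re + t)) * c y - (y.re + t)) 
        (deriv Real.smoothTransition (8 * y.re) * 8 * c y - 1) 0 := by
      have a1 : HasDerivAt (fun t : ℝ => y.re + t) 1 0 := (hasDerivAt_id (0:ℝ)).const_add _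
      have a2 : HasDerivAt (fun t : ℝ => 8 * (y.re + t)) 8 0 := by simpa using a1.const_mul 8
      have a3 : HasDerivAt Real.smoothTransition (deriv Real.smoothTransition (8 * y.re)) 
          (8 * (y.re + 0)) := by
        rw [add_zero]
        exact ((Real.smoothTransition.contDiff (n := 1)).differentiable (by simp) _).hasDerivAt
      exact ((a3.comp (0:ℝ) a2).mul_const (c y)).sub a1
    rw [h4] at h3
    rw [h3.unique h5]; ring
  have hB0 : ∀ s, 0 ≤ deriv Real.smoothTransition s := fun s => Real.smoothTransition.monotone.deriv_nonneg
  have hc0 : ∀ y, 0 ≤ c y := fun y => mul_nonneg (mul_nonneg β.nonneg β.nonneg) β.nonneg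
  refine ⟨Φ, hΦ, fun y => ?_, fun y hy => ?_, ?_⟩
  · rw [hdet]
    exact mul_nonneg (mul_nonneg (by norm_num) (hB0 _)) (hc0 y)
  · rw [hdet]
    by_contra hne
    have hb : deriv Real.smoothTransition (8 * y.re) ≠ 0 := by
      intro h; simp [h] at hne
    have hcy : c y ≠ 0 := by
      intro h; simp [h] at hne
    have r0 : 0 ≤ 8 * y.re ∧ 8 * y.re ≤ 1 := by
      by_contra h
      apply hb
      apply deriv_transition_zero
      by_contra h'
      push Not at h'
      exact h h'
    have hβ' : ∀ t, β t ≠ 0 → |t| ≤ 1/8 := by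
      intro t ht
      by_contra h
      apply ht
      apply β.zero_of_le_dist
      simp only [dist_zero_right, Real.norm_eq_abs, β]
      linarith
    have r1 := hβ' y.imI (by intro h; apply hcy; simp [c, qco_apply, h])
    have r2 := hβ' y.imJ (by intro h; apply hcy; simp [c, qco_apply, h])
    have r3 := hβ' y.imK (by intro h; apply hcy; simp [c, qco_apply, h])
    rw [abs_le] at r1 r2 r3
    have hn : ‖y‖ * ‖y‖ = y.re^2 + y.imI^2 + y.imJ^2 + y.imK^2 := by
      rw [← Quaternion.normSq_eq_norm_mul_self, Quaternion.normSq_def']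
    nlinarith
  · obtain ⟨s, hs, hs'⟩ := exists_deriv_eq_slope Real.smoothTransition (a := 0) (b := 1) one_pos
      Real.smoothTransition.continuous.continuousOn
      ((Real.smoothTransition.contDiff (n := 1)).differentiable (by simp)).differentiableOn
    refine ⟨s / 8, by have := hs.1; positivity, ?_⟩
    rw [hdet]
    have hb0 : β 0 = 1 := β.one_of_mem_closedBall (by simp [β])
    have : ∀ r : ℝ, c (r : ℍ[ℝ]) = 1 := by
      intro r
      simp only [c, qco_apply]
      simp [hb0]
    rw [this]
    simp only [Quaternion.re_coe]
    rw [mul_div_cancel₀ s (by norm_num : (8:ℝ) ≠ 0), hs']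
    norm_num

/-- The quaternion with given components. -/
def qmk (a b c d : ℝ) : ℍ[ℝ] := ⟨a, b, c, d⟩
@[simp] lemma qmk_re (a b c d : ℝ) : (qmk a b c d).re = a := rfl
@[simp] lemma qmk_imI (a b c d : ℝ) : (qmk a b c d).imI = b := rfl
@[simp] lemma qmk_imJ (a b c d : ℝ) : (qmk a b c d).imJ = c := rfl
@[simp] lemma qmk_imK (a b c d : ℝ) : (qmk a b c d).imK = d := rfl

lemma exists_unit_commuting (x : ℍ[ℝ]) : ∃ u : ℍ[ℝ], u * u = -1 ∧ u * x = x * u := by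
  by_cases h : x.im = 0
  · refine ⟨qmk 0 1 0 0, ?_, ?_⟩
    · ext <;> simp
    · have : x = (x.re : ℍ[ℝ]) := by
        conv_lhs => rw [← Quaternion.re_add_im x, h, add_zero]
      rw [this]
      exact (Quaternion.coe_commutes _ _).symm
  · have hr : ‖x.im‖ ≠ 0 := norm_ne_zero_iff.2 h
    have him : x.im * x.im = -((‖x.im‖ * ‖x.im‖ : ℝ) : ℍ[ℝ]) := by
      rw [← Quaternion.normSq_eq_norm_mul_self, ← Quaternion.self_mul_star]
      simp
    refine ⟨(‖x.im‖⁻¹ : ℝ) • x.im, ?_, ?_⟩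
    · rw [smul_mul_smul_comm, him, ← Quaternion.coe_neg, ← Quaternion.coe_smul]
      rw [smul_eq_mul, show ‖x.im‖⁻¹ * ‖x.im‖⁻¹ * -(‖x.im‖ * ‖x.im‖) = -1 by field_simp]
      simp
    · have : x.im * x = x * x.im := by
        conv_lhs => rw [← Quaternion.re_add_im x]
        conv_rhs => rw [← Quaternion.re_add_im x]
        rw [mul_add, add_mul, Quaternion.coe_commutes]
        simp
      rw [smul_mul_assoc, this, mul_smul_comm]

lemma pow_hasFDerivAt (k : ℕ) (x : ℍ[ℝ]) : ∃ L : ℍ[ℝ] →L[ℝ] ℍ[ℝ], 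
    HasFDerivAt (fun x : ℍ[ℝ] => x ^ k) L x ∧ (∀ u, u * x = x * u → ∀ v, L (u * v) = u * L v) ∧
    ((∃ r : ℝ, x = r) → L = (k * x.re ^ (k-1)) • ContinuousLinearMap.id ℝ ℍ[ℝ]) := by
  refine ⟨_, hasFDerivAt_pow' k, ?_, ?_⟩
  · intro u hu v
    simp only [sum_apply, Finset.mul_sum]
    refine Finset.sum_congr rfl fun i _ => ?_
    have : u * x ^ (k.pred - i) = x ^ (k.pred - i) * u := ((Commute.pow_right hu _ :) : Commute _ _)
    simp only [smul_apply, smul_eq_mul, ContinuousLinearMap.id_apply, MulOpposite.smul_eq_mul_unop,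
      MulOpposite.unop_op]
    simp only [← mul_assoc, this]
  · rintro ⟨r, rfl⟩
    ext1 v
    simp only [sum_apply, smul_apply, smul_eq_mul, ContinuousLinearMap.id_apply, 
      MulOpposite.smul_eq_mul_unop, MulOpposite.unop_op]
    have : ∀ i ∈ Finset.range k, (r:ℍ[ℝ]) ^ (k.pred - i) * (v * (r:ℍ[ℝ]) ^ i) = (r ^ (k-1)) • v := by
      intro i hi
      have hi' : i < k := Finset.mem_range.1 hi
      rw [← Quaternion.coe_pow, ← Quaternion.coe_pow, ← Quaternion.coe_commutes, ← mul_assoc, ← Quaternion.coe_mul,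
        ← pow_add, Quaternion.coe_mul_eq_smul]
      congr 2
      simp; omega
    first
    | rw [Finset.sum_congr rfl this]
    | (simp only [← mul_assoc] at this ⊢; rw [Finset.sum_congr rfl this])
    simp [smul_smul, ← Nat.cast_smul_eq_nsmul ℝ]

lemma contDiff_qpow (k : ℕ) : ContDiff ℝ ∞ (fun x : ℍ[ℝ] => x ^ k) := contDiff_id.pow k

lemma pow_det_nonneg (k : ℕ) (x : ℍ[ℝ]) : 0 ≤ (fderiv ℝ (fun x : ℍ[ℝ] => x ^ k) x).det := by
  obtain ⟨L, hL, hc, -⟩ := pow_hasFDerivAt k x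
  obtain ⟨u, hu, hux⟩ := exists_unit_commuting x
  rw [hL.fderiv]
  refine det_nonneg_of_commute (LinearMap.mulLeft ℝ u) (L : ℍ[ℝ] →ₗ[ℝ] ℍ[ℝ]) ?_ ?_
  · ext1 v
    simp [Module.End.mul_apply, ← mul_assoc, hu]
  · intro v
    exact hc u hux v

lemma pow_det_pos (k : ℕ) (hk : k ≠ 0) (r : ℝ) (hr : 0 < r) :
    0 < (fderiv ℝ (fun x : ℍ[ℝ] => x ^ k) (r : ℍ[ℝ])).det := by
  obtain ⟨L, hL, -, hc⟩ := pow_hasFDerivAt k r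
  rw [hL.fderiv, hc ⟨r, rfl⟩, ContinuousLinearMap.det]
  have : 0 < (k:ℝ) * r ^ (k-1) := by positivity
  simp only [ContinuousLinearMap.toLinearMap_smul, LinearMap.det_smul, Quaternion.re_coe]
  simp
  positivity

lemma no_ext (k : ℕ) (hk : k ≠ 0) (G : ℍ[ℝ] → ℍ[ℝ]) (hG : Continuous G) (hG1 : ∀ x, 1 ≤ ‖G x‖)
    (hGP : ∀ x, 1 ≤ ‖x‖ → G x = x ^ k) : False := by
  borelize ℍ[ℝ]
  obtain ⟨Φ, hΦ, hΦ0, hΦz, t, ht, htp⟩ := exists_Phi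
  have hP := contDiff_qpow k
  set P : ℍ[ℝ] → ℍ[ℝ] := fun x => x ^ k with hPdef
  have hkc : Continuous (fun x => G x - P x) := hG.sub hP.continuous
  have hks : HasCompactSupport (fun x => G x - P x) := by
    refine HasCompactSupport.intro (isCompact_closedBall (0:ℍ[ℝ]) 1) fun x hx => ?_
    rw [mem_closedBall_zero_iff, not_le] at hx
    simp [hGP x hx.le, P]
  obtain ⟨δ, hδ, hδu⟩ := Metric.uniformContinuous_iff.1 (hks.uniformContinuous_of_continuous hkc)
    (1/2) (by norm_num)
  obtain ⟨g, hg, hgd⟩ := hkc.exists_contDiff_dist_le_of_forall_mem_ball_dist_le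
    (lt_min hδ one_pos : 0 < min δ 1)
  have hg0 : ∀ a, 2 < ‖a‖ → g a = 0 := by
    intro a ha
    have key : ∀ x ∈ Metric.ball a (min δ 1), G x - P x = 0 := by
      intro x hx
      have h1 : dist x a < 1 := lt_of_lt_of_le hx (min_le_right _ _)
      have h2 : ‖a‖ ≤ ‖x‖ + dist x a := by
        rw [dist_comm, dist_eq_norm]
        have := norm_add_le x (a - x)
        simpa using this
      simp [hGP x (by linarith), P]
    have hpos : 0 < min δ 1 := lt_min hδ one_pos
    have := hgd a 0 (fun x hx => by rw [key x hx, key a (Metric.mem_ball_self hpos)]; simp)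
    rw [key a (Metric.mem_ball_self hpos)] at this
    simpa using this
  have hgn : ∀ a, 1/2 ≤ ‖P a + g a‖ := by
    intro a
    have := hgd a (1/2) (fun x hx => (hδu (lt_of_lt_of_le hx (min_le_left _ _))).le)
    rw [dist_eq_norm] at this
    have h2 := norm_sub_norm_le (G a) (-(g a - (G a - P a)))
    have h3 : G a - -(g a - (G a - P a)) = P a + g a := by abel
    rw [h3, norm_neg] at h2
    have := hG1 a
    linarith
  have hQ : ContDiff ℝ ∞ (fun x => P x + g x) := hP.add hg
  have hchain : ∀ F : ℍ[ℝ] → ℍ[ℝ], ContDiff ℝ ∞ F → ∀ x, (fderiv ℝ (Φ ∘ F) x).det =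
      (fderiv ℝ Φ (F x)).det * (fderiv ℝ F x).det := by
    intro F hF x
    rw [fderiv_comp x (hΦ.differentiable (by simp) _) (hF.differentiable (by simp) _)]
    simp [ContinuousLinearMap.det, LinearMap.det_comp]
  have hinv := det_invariance (MeasureTheory.Measure.addHaar (G := ℍ[ℝ])) 
    (QuaternionAlgebra.basisOneIJK (-1:ℝ) 0 (-1))
    (F := Φ ∘ P) (G := Φ ∘ (fun x => P x + g x)) (hΦ.comp hP) (hΦ.comp hQ) (by
      refine HasCompactSupport.intro (isCompact_closedBall (0:ℍ[ℝ]) 2) fun x hx => ?_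
      rw [mem_closedBall_zero_iff, not_le] at hx
      simp [hg0 x hx])
  have heq : ∀ x, (fderiv ℝ (Φ ∘ P) x).det - (fderiv ℝ (Φ ∘ (fun x => P x + g x)) x).det
      = (fderiv ℝ Φ (P x)).det * (fderiv ℝ P x).det := by
    intro x
    rw [hchain P hP, hchain _ hQ, hΦz _ (hgn x)]
    simp
  simp_rw [heq] at hinv
  have hcont : ∀ F : ℍ[ℝ] → ℍ[ℝ], ContDiff ℝ ∞ F → Continuous fun x => (fderiv ℝ F x).det := 
    fun F hF => ContinuousLinearMap.continuous_det.comp (hF.continuous_fderiv (by simp))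
  have hpos := Continuous.integral_pos_of_hasCompactSupport_nonneg_nonzero 
    (μ := MeasureTheory.Measure.addHaar (G := ℍ[ℝ]))
    (f := fun x => (fderiv ℝ Φ (P x)).det * (fderiv ℝ P x).det)
    (x := ((t ^ ((k:ℝ)⁻¹) : ℝ) : ℍ[ℝ]))
    (((hcont Φ hΦ).comp hP.continuous).mul (hcont P hP))
    (by
      refine HasCompactSupport.intro (isCompact_closedBall (0:ℍ[ℝ]) 1) fun x hx => ?_
      rw [mem_closedBall_zero_iff, not_le] at hx
      have : 1/2 ≤ ‖P x‖ := by
        simp only [P, norm_pow]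
        have := one_le_pow₀ hx.le (n := k)
        linarith
      simp [hΦz _ this])
    (fun x => mul_nonneg (hΦ0 _) (pow_det_nonneg k x))
    (by
      have h1 : P ((t ^ ((k:ℝ)⁻¹) : ℝ) : ℍ[ℝ]) = (t : ℍ[ℝ]) := by
        simp only [P]
        rw [← Quaternion.coe_pow, Real.rpow_inv_natCast_pow ht.le hk]
      refine mul_ne_zero ?_ (pow_det_pos k hk _ (Real.rpow_pos_of_pos ht _)).ne'
      rw [h1]
      exact htp.ne')
  exact hpos.ne' hinv
section Topo
variable {X : Type*} [TopologicalSpace X]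

lemma homotopic_of_not_antipodal {V : Type*} [NormedAddCommGroup V] [NormedSpace ℝ V]
    (f g : C(X, Metric.sphere (0:V) 1)) (h : ∀ x, (f x : V) ≠ -(g x : V)) : f.Homotopic g := by
  have hn : ∀ (y : Metric.sphere (0:V) 1), ‖(y:V)‖ = 1 := fun y => by simp
  let w : unitInterval × X → V := fun p => (1 - (p.1 : ℝ)) • (f p.2 : V) + (p.1 : ℝ) • (g p.2 : V)
  have hw : Continuous w := by fun_prop
  have hw0 : ∀ p, w p ≠ 0 := by
    rintro ⟨t, x⟩ h0
    have h1 : (1 - (t : ℝ)) • (f x : V) = -((t : ℝ) • (g x : V)) := eq_neg_of_add_eq_zero_left h0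
    have h2 := congrArg norm h1
    rw [norm_neg, norm_smul, norm_smul, hn, hn, Real.norm_of_nonneg (by linarith [t.2.2]),
      Real.norm_of_nonneg t.2.1] at h2
    have h3 : (t:ℝ) = 1/2 := by linarith
    rw [h3, ← smul_neg, show (1 - 1/2 : ℝ) = 1/2 by norm_num] at h1
    exact h x (smul_right_injective V (by norm_num : (1/2:ℝ) ≠ 0) h1)
  have hwn : ∀ p, ‖w p‖ ≠ 0 := fun p => norm_ne_zero_iff.2 (hw0 p)
  refine ⟨⟨⟨fun p => ⟨‖w p‖⁻¹ • w p, ?_⟩, ?_⟩, ?_, ?_⟩⟩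
  · simp [norm_smul, hwn p]
  · exact Continuous.subtype_mk ((hw.norm.inv₀ hwn).smul hw) _
  · intro x
    ext1
    simp [w]
  · intro x
    ext1
    simp [w]

local notation "S3" => Metric.sphere (0 : EuclideanSpace ℝ (Fin 4)) 1
local notation "S2" => Metric.sphere (0 : EuclideanSpace ℝ (Fin 3)) 1
local notation "TT" => Metric.sphere (0 : ℍ[ℝ]) 1

/-- The quaternion unit `i`. -/
def qi : ℍ[ℝ] := qmk 0 1 0 0

lemma norm_sq_q (y : ℍ[ℝ]) : ‖y‖^2 = y.re^2 + y.imI^2 + y.imJ^2 + y.imK^2 := by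
  rw [sq, ← Quaternion.normSq_eq_norm_mul_self, Quaternion.normSq_def']

lemma norm_qi : ‖qi‖ = 1 := by
  have := norm_sq_q qi
  have h2 : ‖qi‖^2 = 1 := by rw [this]; simp [qi]
  exact (pow_eq_one_iff_of_nonneg (norm_nonneg _) two_ne_zero).1 h2

/-- Embedding of 3-space as imaginary quaternions. -/
def imq (v : EuclideanSpace ℝ (Fin 3)) : ℍ[ℝ] := qmk 0 (v 0) (v 1) (v 2)

lemma norm_imq (v : EuclideanSpace ℝ (Fin 3)) : ‖imq v‖ = ‖v‖ := by
  have h := norm_sq_q (imq v)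
  have h2 : ‖v‖^2 = v 0 ^2 + v 1 ^ 2 + v 2 ^ 2 := by
    rw [EuclideanSpace.norm_sq_eq, Fin.sum_univ_three]; simp
  simp only [imq, qmk_re, qmk_imI, qmk_imJ, qmk_imK] at h
  have : ‖imq v‖^2 = ‖v‖^2 := by rw [h2, imq, h]; ring
  exact (sq_eq_sq₀ (norm_nonneg _) (norm_nonneg _)).1 this

lemma imq_inj {v w : EuclideanSpace ℝ (Fin 3)} (h : imq v = imq w) : v = w := by
  ext i
  fin_cases i
  · exact congrArg (fun q : ℍ[ℝ] => q.imI) h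
  · exact congrArg (fun q : ℍ[ℝ] => q.imJ) h
  · exact congrArg (fun q : ℍ[ℝ] => q.imK) h

lemma imq_neg (v : EuclideanSpace ℝ (Fin 3)) : imq (-v) = - imq v := by
  ext <;> simp [imq]

lemma continuous_qmk {a b c d : X → ℝ} (ha : Continuous a) (hb : Continuous b) (hc : Continuous c)
    (hd : Continuous d) : Continuous fun x => qmk (a x) (b x) (c x) (d x) := by
  have : Continuous fun x => (Quaternion.linearIsometryEquivTuple.symm !₂[a x, b x, c x, d x]) := by
    apply Quaternion.linearIsometryEquivTuple.symm.continuous.comp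
    fun_prop
  convert this using 2
  rw [Quaternion.linearIsometryEquivTuple_symm_apply]
  ext <;> simp

lemma continuous_imq : Continuous imq := 
  continuous_qmk (by fun_prop) (by fun_prop) (by fun_prop) (by fun_prop)

lemma imq_sq (v : EuclideanSpace ℝ (Fin 3)) (hv : ‖v‖ = 1) : imq v * imq v = -1 := by
  have h := norm_sq_q (imq v)
  rw [norm_imq, hv] at h
  simp only [imq, qmk_re, qmk_imI, qmk_imJ, qmk_imK] at h
  ext
  · simp [imq]; linarith
  · simp [imq]; ring
  · simp [imq]; ring
  · simp [imq]; ring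

lemma hopf_re (u : ℍ[ℝ]) : (u * qi * star u).re = 0 := by
  simp [qi]; ring

/-- The Hopf map. -/
noncomputable def hopf (u : ℍ[ℝ]) : EuclideanSpace ℝ (Fin 3) :=
  !₂[(u * qi * star u).imI, (u * qi * star u).imJ, (u * qi * star u).imK]

lemma imq_hopf (u : ℍ[ℝ]) : imq (hopf u) = u * qi * star u := by
  ext <;> simp only [imq, hopf, qmk_re, qmk_imI, qmk_imJ, qmk_imK, hopf_re] <;> simp

lemma continuous_hopf : Continuous hopf := by
  unfold hopf
  have h1 : Continuous fun u : ℍ[ℝ] => u * qi * star u := by fun_prop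
  have := Quaternion.continuous_imI.comp h1
  have := Quaternion.continuous_imJ.comp h1
  have := Quaternion.continuous_imK.comp h1
  simp only [Function.comp_def] at *
  fun_prop

lemma norm_hopf (u : ℍ[ℝ]) (hu : ‖u‖ = 1) : ‖hopf u‖ = 1 := by
  rw [← norm_imq, imq_hopf]
  simp [hu, norm_qi]

/-- The Hopf map on spheres. -/
noncomputable def hopfC : C(TT, S2) :=
  ⟨fun u => ⟨hopf u, by simpa using norm_hopf u (by simp)⟩,
    by refine Continuous.subtype_mk ?_ _; exact continuous_hopf.comp continuous_subtype_val⟩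

lemma star_mul_self_one (u : ℍ[ℝ]) (hu : ‖u‖ = 1) : u * star u = 1 := by
  rw [Quaternion.self_mul_star, Quaternion.normSq_eq_norm_mul_self, hu]; simp

lemma lift_step (F : C(X, TT)) (g : C(X, S2)) 
    (h : ∀ x, (g x : EuclideanSpace ℝ (Fin 3)) ≠ - (hopfC (F x) : EuclideanSpace ℝ (Fin 3))) :
    ∃ F' : C(X, TT), F'.Homotopic F ∧ hopfC.comp F' = g := by
  let p : X → ℍ[ℝ] := fun x => imq (hopfC (F x))
  let q : X → ℍ[ℝ] := fun x => imq (g x)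
  have hFn : ∀ x, ‖(F x : ℍ[ℝ])‖ = 1 := fun x => by simp
  have hpn : ∀ x, ‖p x‖ = 1 := fun x => by simp [p, norm_imq]
  have hqn : ∀ x, ‖q x‖ = 1 := fun x => by simp [q, norm_imq]
  have hp2 : ∀ x, p x * p x = -1 := fun x => imq_sq _ (by simp)
  have hq2 : ∀ x, q x * q x = -1 := fun x => imq_sq _ (by simp)
  have hpc : Continuous p := continuous_imq.comp
    (continuous_subtype_val.comp (hopfC.continuous.comp F.continuous))
  have hqc : Continuous q := continuous_imq.comp (by fun_prop)
  let r : X → ℍ[ℝ] := fun x => 1 - q x * p x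
  have hrc : Continuous r := by fun_prop
  have hr0 : ∀ x, r x ≠ 0 := by
    intro x h0
    have h1 : q x * p x = 1 := (sub_eq_zero.1 h0).symm
    have h2 : q x = - p x := by
      have := congrArg (· * p x) h1
      simp only [mul_assoc, hp2, one_mul] at this
      rw [← this]; simp
    apply h x
    apply imq_inj
    rw [imq_neg]
    exact h2
  have hrn : ∀ x, ‖r x‖ ≠ 0 := fun x => norm_ne_zero_iff.2 (hr0 x)
  have hrp : ∀ x, r x * p x = q x * r x := by
    intro x
    simp only [r, sub_mul, mul_sub, mul_assoc, hp2]
    rw [← mul_assoc, hq2]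
    simp [add_comm]
  let F' : C(X, TT) := ⟨fun x => ⟨‖r x‖⁻¹ • (r x * (F x : ℍ[ℝ])), by
      simp [norm_smul, hrn x]⟩,
    by
      refine Continuous.subtype_mk ?_ _
      exact (hrc.norm.inv₀ hrn).smul (hrc.mul (by fun_prop))⟩
  refine ⟨F', ?_, ?_⟩
  · apply homotopic_of_not_antipodal
    intro x hx
    have hx' : ‖r x‖⁻¹ • (r x * (F x : ℍ[ℝ])) = - (F x : ℍ[ℝ]) := hx
    have h1 : r x * (F x : ℍ[ℝ]) = -(‖r x‖ • (F x : ℍ[ℝ])) := by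
      rw [← smul_neg, ← hx', smul_smul, mul_inv_cancel₀ (hrn x), one_smul]
    have h2 : r x = -((‖r x‖ : ℝ) : ℍ[ℝ]) := by
      have := congrArg (· * star (F x : ℍ[ℝ])) h1
      simp only [mul_assoc, neg_mul, smul_mul_assoc, star_mul_self_one _ (hFn x), mul_one] at this
      rw [← Quaternion.coe_mul_eq_smul, mul_one] at this
      exact this
    have h3 : q x * p x = ((1 + ‖r x‖ : ℝ) : ℍ[ℝ]) := by
      have : q x * p x = 1 - r x := by simp [r]
      rw [this]
      conv_lhs => rw [h2]
      simp
    have h4 := congrArg norm h3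
    rw [norm_mul, hqn, hpn, Quaternion.norm_coe] at h4
    have h5 : 0 < ‖r x‖ := norm_pos_iff.2 (hr0 x)
    rw [Real.norm_of_nonneg (by positivity)] at h4
    linarith
  · ext1 x
    apply Subtype.ext
    apply imq_inj
    change imq (hopf (‖r x‖⁻¹ • (r x * (F x : ℍ[ℝ])))) = q x
    rw [imq_hopf]
    have hp' : (F x : ℍ[ℝ]) * qi * star (F x : ℍ[ℝ]) = p x := (imq_hopf _).symm
    have : (‖r x‖⁻¹ • (r x * (F x : ℍ[ℝ]))) * qi * star (‖r x‖⁻¹ • (r x * (F x : ℍ[ℝ]))) =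
      (‖r x‖⁻¹ * ‖r x‖⁻¹) • (r x * ((F x : ℍ[ℝ]) * qi * star (F x : ℍ[ℝ])) * star (r x)) := by
      simp only [Quaternion.star_smul, star_mul, smul_mul_assoc, mul_smul_comm, smul_smul, mul_assoc]
    rw [this, hp', hrp, mul_assoc, Quaternion.self_mul_star, Quaternion.normSq_eq_norm_mul_self,
      ← Quaternion.coe_commutes, Quaternion.coe_mul_eq_smul, smul_smul]
    have hh := hrn x
    rw [show ‖r x‖⁻¹ * ‖r x‖⁻¹ * (‖r x‖ * ‖r x‖) = 1 by field_simp, one_smul]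

lemma ne_neg_of_dist_lt {V : Type*} [NormedAddCommGroup V] [NormedSpace ℝ V]
    {a b : Metric.sphere (0:V) 1} (h : dist a b < 2) : (a : V) ≠ -(b : V) := by
  intro hab
  rw [Subtype.dist_eq, hab, dist_eq_norm, ← neg_add', norm_neg, ← two_smul ℝ (b:V), norm_smul] at h
  simp at h

lemma lift_homotopy [CompactSpace X] (F : C(X, TT)) (g : C(X, S2)) 
    (h : (hopfC.comp F).Homotopic g) :
    ∃ F' : C(X, TT), F'.Homotopic F ∧ hopfC.comp F' = g := by
  obtain ⟨H⟩ := h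
  let Q : C(X, S2) → Prop := fun g => ∃ F' : C(X, TT), F'.Homotopic F ∧ hopfC.comp F' = g
  have hQ : ∀ g g' : C(X, S2), dist g' g < 2 → Q g → Q g' := by
    rintro g g' hd ⟨F₁, h1, rfl⟩
    obtain ⟨F₂, h2, h3⟩ := lift_step F₁ g' (fun x => 
      ne_neg_of_dist_lt (lt_of_le_of_lt (ContinuousMap.dist_apply_le_dist (f := g') (g := hopfC.comp F₁) x) hd))
    exact ⟨F₂, h2.trans h1, h3⟩
  have key := (isPreconnected_univ (α := unitInterval)).induction₂ 
    (fun s t => Q (H.curry s) ↔ Q (H.curry t)) 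
    (by
      intro s _
      rw [nhdsWithin_univ]
      have : ∀ᶠ t in nhds s, dist (H.curry t) (H.curry s) < 2 := 
        H.curry.continuous.continuousAt.eventually (Metric.ball_mem_nhds _ two_pos)
      filter_upwards [this] with t ht
      exact ⟨hQ _ _ ht, hQ _ _ (by rwa [dist_comm])⟩)
    (fun _ _ _ _ _ _ h1 h2 => h1.trans h2) (fun _ _ _ _ h => h.symm) 
    (Set.mem_univ 0) (Set.mem_univ 1)
  rw [H.curry_zero, H.curry_one] at key
  exact key.1 ⟨F, ContinuousMap.Homotopic.refl F, rfl⟩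

/-- The identification of the standard 3-sphere with unit quaternions. -/
noncomputable def toQ : C(S3, TT) :=
  ⟨fun x => ⟨Quaternion.linearIsometryEquivTuple.symm (x : EuclideanSpace ℝ (Fin 4)), by
    simp only [mem_sphere_zero_iff_norm]; rw [LinearIsometryEquiv.norm_map]; simp⟩,
    by
      refine Continuous.subtype_mk ?_ _
      exact Quaternion.linearIsometryEquivTuple.symm.continuous.comp continuous_subtype_val⟩

/-- The quaternion unit `j`. -/
def qj : ℍ[ℝ] := qmk 0 0 1 0

lemma norm_qj : ‖qj‖ = 1 := by
  have := norm_sq_q qj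
  have h2 : ‖qj‖^2 = 1 := by rw [this]; simp [qj]
  exact (pow_eq_one_iff_of_nonneg (norm_nonneg _) two_ne_zero).1 h2

/-- `j` as a point of the unit sphere. -/
def qjT : TT := ⟨qj, by simpa using norm_qj⟩

lemma not_null (k : ℕ) (hk : k ≠ 0) : ¬ (ContinuousMap.const S3 qjT).Homotopic (toQ ^ k) := by
  rintro ⟨K⟩
  let e := Quaternion.linearIsometryEquivTuple
  let x₀ : S3 := ⟨e qj, by simp only [mem_sphere_zero_iff_norm]; rw [LinearIsometryEquiv.norm_map]; exact norm_qj⟩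
  classical
  let n : ℍ[ℝ] → S3 := fun x => if h : x = 0 then x₀ else ⟨e (‖x‖⁻¹ • x), by 
    simp only [mem_sphere_zero_iff_norm]; rw [LinearIsometryEquiv.norm_map]; simp [norm_smul, h]⟩
  have hn : ∀ x : ℍ[ℝ], x ≠ 0 → (n x : EuclideanSpace ℝ (Fin 4)) = e (‖x‖⁻¹ • x) := by
    intro x hx
    simp [n, hx]
  have hnc : ∀ x : ℍ[ℝ], x ≠ 0 → ContinuousAt n x := by
    intro x hx
    rw [Topology.IsInducing.subtypeVal.continuousAt_iff]
    have h1 : ContinuousAt (fun x : ℍ[ℝ] => e (‖x‖⁻¹ • x)) x := by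
      refine e.continuous.continuousAt.comp ?_
      exact (continuous_norm.continuousAt.inv₀ (norm_ne_zero_iff.2 hx)).smul continuousAt_id
    refine h1.congr ?_
    filter_upwards [isOpen_ne.mem_nhds hx] with y hy
    exact (hn y hy).symm
  let τ : ℍ[ℝ] → unitInterval := fun x => Set.projIcc 0 1 zero_le_one (2 * ‖x‖ - 1)
  have hτ : Continuous τ := continuous_projIcc.comp (by fun_prop)
  let G : ℍ[ℝ] → ℍ[ℝ] := fun x => ((max 1 ‖x‖)^k) • (K (τ x, n x) : ℍ[ℝ])
  have hG0 : ∀ x, ‖x‖ < 1/2 → G x = qj := by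
    intro x hx
    have h1 : τ x = 0 := Set.projIcc_of_le_left _ (by linarith)
    have h2 : max 1 ‖x‖ = 1 := max_eq_left (by linarith)
    simp only [G, h1, h2]
    rw [one_pow, one_smul, ContinuousMap.Homotopy.apply_zero]
    rfl
  refine no_ext k hk G ?_ ?_ ?_
  · rw [continuous_iff_continuousAt]
    intro x
    by_cases hx : x = 0
    · subst hx
      refine (continuousAt_const (y := qj)).congr ?_
      filter_upwards [Metric.ball_mem_nhds (0:ℍ[ℝ]) (by norm_num : (0:ℝ) < 1/2)] with y hy
      exact (hG0 y (by simpa using hy)).symm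
    · have h1 : ContinuousAt (fun x => (τ x, n x)) x := hτ.continuousAt.prodMk (hnc x hx)
      have h2 : ContinuousAt (fun x => (K (τ x, n x) : ℍ[ℝ])) x := 
        (continuous_subtype_val.comp K.continuous).continuousAt.comp h1
      have h3 : Continuous (fun x : ℍ[ℝ] => (max 1 ‖x‖)^k) := by fun_prop
      exact h3.continuousAt.smul h2
  · intro x
    simp only [G, norm_smul, norm_pow]
    rw [Real.norm_of_nonneg (by positivity)]
    simp only [norm_eq_of_mem_sphere, mul_one]
    exact one_le_pow₀ (le_max_left _ _)
  · intro x hx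
    have hx0 : x ≠ 0 := by rintro rfl; simp at hx; linarith
    have h1 : τ x = 1 := Set.projIcc_of_right_le _ (by linarith)
    have h2 : max 1 ‖x‖ = ‖x‖ := max_eq_right hx
    have h3 : ((toQ (n x) : TT) : ℍ[ℝ]) = ‖x‖⁻¹ • x := by
      change e.symm (n x) = _
      rw [hn x hx0, LinearIsometryEquiv.symm_apply_apply]
    simp only [G, h1, h2]
    simp only [ContinuousMap.Homotopy.apply_one, ContinuousMap.pow_apply, Metric.unitSphere.coe_pow]
    rw [h3, smul_pow, smul_smul, ← mul_pow, mul_inv_cancel₀ (norm_ne_zero_iff.2 hx0)]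
    simp

lemma commute_qi_ne (c : ℍ[ℝ]) (h : c * qi = qi * c) : qj ≠ -c := by
  intro hc
  rw [← neg_eq_iff_eq_neg] at hc
  subst hc
  have := congrArg (fun q : ℍ[ℝ] => q.imK) h
  simp [qi, qj] at this
  norm_num at this

lemma hopf_pow_not_homotopic {m n : ℕ} (hmn : n < m) : 
    ¬ (hopfC.comp (toQ ^ m)).Homotopic (hopfC.comp (toQ ^ n)) := by
  intro h
  obtain ⟨F', hF', hF2⟩ := lift_homotopy _ _ h
  let c : C(S3, TT) := (toQ ^ n)⁻¹ * F'
  have h1 : c.Homotopic (toQ ^ (m - n)) := by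
    have := (ContinuousMap.Homotopic.refl (⟨fun p => p.1 * p.2, continuous_mul⟩ : C(TT × TT, TT))).comp 
      ((ContinuousMap.Homotopic.refl (toQ ^ n)⁻¹).prodMk hF')
    have h2 : toQ ^ (m - n) = (toQ ^ n)⁻¹ * toQ ^ m := by
      rw [eq_inv_mul_iff_mul_eq, ← pow_add]; congr 1; omega
    rw [h2]
    exact this
  refine not_null (m - n) (by omega) (ContinuousMap.Homotopic.trans ?_ h1)
  apply homotopic_of_not_antipodal
  intro x
  apply commute_qi_ne
  set a : ℍ[ℝ] := (((toQ ^ n : C(S3, TT)) x : TT) : ℍ[ℝ]) with ha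
  set b : ℍ[ℝ] := ((F' x : TT) : ℍ[ℝ]) with hb
  have hab : b * qi * star b = a * qi * star a := by
    rw [← imq_hopf, ← imq_hopf]
    congr 1
    exact congrArg Subtype.val (congrArg (fun f : C(S3, S2) => f x) hF2)
  have hcx : (c x : ℍ[ℝ]) = a⁻¹ * b := by simp [c, a, b]
  have han : ‖a‖ = 1 := by simp [a]
  have hbn : ‖b‖ = 1 := by simp [b]
  have ha0 : a ≠ 0 := by rintro h; simp [h] at han
  have hsa : star a = a⁻¹ := eq_inv_of_mul_eq_one_right (star_mul_self_one a han)
  have hsb : star b = b⁻¹ := eq_inv_of_mul_eq_one_right (star_mul_self_one b hbn)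
  have hb0 : b ≠ 0 := by rintro h; simp [h] at hbn
  rw [hcx]
  rw [hsa, hsb] at hab
  have h5 : b * qi = a * qi * a⁻¹ * b := by
    rw [← hab]; simp [mul_assoc, hb0]
  rw [mul_assoc, h5]
  simp [← mul_assoc, ha0]
end Topo

/-- The set of (unbased) homotopy classes of continuous maps `S³ → S²` is in bijection
with the integers `ℤ`. -/
theorem homotopy_classes_sphere3_sphere2_equiv_int :
    Nonempty
      ((Quot (fun f g : C(Metric.sphere (0 : EuclideanSpace ℝ (Fin 4)) 1,
            Metric.sphere (0 : EuclideanSpace ℝ (Fin 3)) 1) =>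
          f.Homotopic g)) ≃ ℤ) := by
  have hc : Countable (Quot (fun f g : C(Metric.sphere (0 : EuclideanSpace ℝ (Fin 4)) 1,
            Metric.sphere (0 : EuclideanSpace ℝ (Fin 3)) 1) => f.Homotopic g)) := by
    obtain ⟨s, hs, hd⟩ := TopologicalSpace.exists_countable_dense
      C(Metric.sphere (0 : EuclideanSpace ℝ (Fin 4)) 1, Metric.sphere (0 : EuclideanSpace ℝ (Fin 3)) 1)
    have := hs.to_subtype
    refine Function.Surjective.countable (f := fun a : s => Quot.mk _ a.1) ?_
    intro q
    induction q using Quot.ind with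
    | mk f =>
      obtain ⟨g, hg, hfg⟩ := Metric.dense_iff.1 hd f 2 two_pos
      refine ⟨⟨g, hfg⟩, Quot.sound ?_⟩
      exact homotopic_of_not_antipodal _ _ fun x => 
        ne_neg_of_dist_lt (lt_of_le_of_lt (ContinuousMap.dist_apply_le_dist x) hg)
  have hi : Infinite (Quot (fun f g : C(Metric.sphere (0 : EuclideanSpace ℝ (Fin 4)) 1,
            Metric.sphere (0 : EuclideanSpace ℝ (Fin 3)) 1) => f.Homotopic g)) := by
    refine Infinite.of_injective (fun n : ℕ => Quot.mk _ (hopfC.comp (toQ ^ n))) ?_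
    intro m n hmn
    have h : (hopfC.comp (toQ ^ m)).Homotopic (hopfC.comp (toQ ^ n)) := 
      ContinuousMap.Homotopic.equivalence.quot_mk_eq_iff _ _ |>.1 hmn
    by_contra hne
    rcases lt_or_gt_of_ne hne with h' | h'
    · exact hopf_pow_not_homotopic h' h.symm
    · exact hopf_pow_not_homotopic h' h
  obtain ⟨d⟩ := nonempty_denumerable (Quot (fun f g : C(Metric.sphere (0 : EuclideanSpace ℝ (Fin 4)) 1,
            Metric.sphere (0 : EuclideanSpace ℝ (Fin 3)) 1) => f.Homotopic g))
  exact ⟨Denumerable.equiv₂ _ _⟩
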